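/- Let C be an induced cycle in a finite graph G such that at most n ≥ 2 vertices of C have neighbours in G \ C, and suppose c(H) ≤ c for every induced subgraph H of G \ C. Then c(G) ≤ c · ℓ(n), where ℓ(n) is the n-th Lucas number. -/

import Mathlib

open Classical

variable {V : Type*}

/-- A finset of vertices is independent if no two of its members are adjacent. -/
def IsIndepSet (G : SimpleGraph V) (s : Finset V) : Prop :=
  ∀ u ∈ s, ∀ v ∈ s, ¬ G.Adj u v

/-- The set of faces of the independence complex of `G` (including the empty face). -/
def IndFaces (G : SimpleGraph V) : Set (Finset V) :=
  {s | IsIndepSet G s}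

/-- `P` is a matching on the face poset `Δ`: a set of disjoint covering pairs. -/
def IsPosetMatching (Δ : Set (Finset V)) (P : Set (Finset V × Finset V)) : Prop :=
  (∀ p ∈ P, p.1 ∈ Δ ∧ p.2 ∈ Δ ∧ p.1 ⊆ p.2 ∧ p.2.card = p.1.card + 1) ∧
  (∀ p ∈ P, ∀ q ∈ P, p ≠ q → p.1 ≠ q.1 ∧ p.1 ≠ q.2 ∧ p.2 ≠ q.1 ∧ p.2 ≠ q.2)

/-- A cycle in a matching: distinct matched pairs `{σ₁⊂τ₁},…,{σₙ⊂τₙ}`, `n > 1`,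
with `σ_{i+1} ⊂ τ_i` for `i < n` and `σ₁ ⊂ τₙ`. -/
def MatchingHasCycle (P : Set (Finset V × Finset V)) : Prop :=
  ∃ n : ℕ, 2 ≤ n ∧ ∃ f : ℕ → Finset V × Finset V,
    (∀ i < n, f i ∈ P) ∧ Set.InjOn f (Set.Iio n) ∧
    (∀ i, i + 1 < n → (f (i + 1)).1 ⊂ (f i).2) ∧ (f 0).1 ⊂ (f (n - 1)).2

/-- An acyclic (Morse) matching on the face poset `Δ`. -/
def IsAcyclicMatching (Δ : Set (Finset V)) (P : Set (Finset V × Finset V)) : Prop :=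
  IsPosetMatching Δ P ∧ ¬ MatchingHasCycle P

/-- The critical (unmatched) faces of `Δ` with respect to `P`. -/
def criticalSet (Δ : Set (Finset V)) (P : Set (Finset V × Finset V)) : Set (Finset V) :=
  {s ∈ Δ | ∀ p ∈ P, s ≠ p.1 ∧ s ≠ p.2}

/-- `cInvariant G` is the minimal number of critical cells in an acyclic matching on the
face poset of the independence complex of `G`. -/
noncomputable def cInvariant (G : SimpleGraph V) : ℕ :=
  sInf {n | ∃ P, IsAcyclicMatching (IndFaces G) P ∧ (criticalSet (IndFaces G) P).ncard = n}

/-- The Lucas numbers: `ℓ(n) = φ(n-1) + φ(n+1)` where `φ` is the Fibonacci sequence. -/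
def lucas : ℕ → ℕ
  | 0 => 2
  | n + 1 => Nat.fib n + Nat.fib (n + 2)

/-- Transport of acyclic matchings along an order embedding shifting cardinalities. -/
theorem transport_aux {A B : Type*} [Finite A] (Δ : Set (Finset A)) (φ : Finset A → Finset B) (r : ℕ)
    (hsub : ∀ s ∈ Δ, ∀ t ∈ Δ, (φ s ⊆ φ t ↔ s ⊆ t))
    (hcard : ∀ s ∈ Δ, (φ s).card = s.card + r)
    (P : Set (Finset A × Finset A)) (hP : IsAcyclicMatching Δ P) :
    ∃ P' : Set (Finset B × Finset B), IsAcyclicMatching (φ '' Δ) P' ∧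
      (criticalSet (φ '' Δ) P').ncard ≤ (criticalSet Δ P).ncard := by
  have hinj : ∀ s ∈ Δ, ∀ t ∈ Δ, φ s = φ t → s = t := by
    intro s hs t ht h
    exact Finset.Subset.antisymm ((hsub s hs t ht).1 h.subset) ((hsub t ht s hs).1 h.symm.subset)
  have hss : ∀ s ∈ Δ, ∀ t ∈ Δ, φ s ⊂ φ t → s ⊂ t := by
    intro s hs t ht h
    rw [Finset.ssubset_def] at h ⊢
    exact ⟨(hsub s hs t ht).1 h.1, fun h' => h.2 ((hsub t ht s hs).2 h')⟩
  obtain ⟨⟨h1, h2⟩, h3⟩ := hP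
  refine ⟨(fun p => (φ p.1, φ p.2)) '' P, ⟨⟨?_, ?_⟩, ?_⟩, ?_⟩
  · rintro _ ⟨p, hp, rfl⟩
    obtain ⟨a, b, d, e⟩ := h1 p hp
    refine ⟨⟨_, a, rfl⟩, ⟨_, b, rfl⟩, (hsub _ a _ b).2 d, ?_⟩
    simp only [hcard _ a, hcard _ b]; omega
  · rintro _ ⟨p, hp, rfl⟩ _ ⟨q, hq, rfl⟩ hne
    have hpq : p ≠ q := by rintro rfl; exact hne rfl
    obtain ⟨a, b, -, -⟩ := h1 p hp
    obtain ⟨a', b', -, -⟩ := h1 q hq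
    obtain ⟨x, y, z, w⟩ := h2 p hp q hq hpq
    exact ⟨fun h => x (hinj _ a _ a' h), fun h => y (hinj _ a _ b' h),
      fun h => z (hinj _ b _ a' h), fun h => w (hinj _ b _ b' h)⟩
  · rintro ⟨n, hn, f, hf, hfi, hs, hw⟩
    apply h3
    have : ∀ i, ∃ p : Finset A × Finset A, i < n → p ∈ P ∧ (φ p.1, φ p.2) = f i := by
      intro i
      by_cases hi : i < n
      · obtain ⟨p, hp, h⟩ := hf i hi
        exact ⟨p, fun _ => ⟨hp, h⟩⟩
      · exact ⟨(∅, ∅), fun h => absurd h hi⟩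
    choose g hg using this
    refine ⟨n, hn, g, fun i hi => (hg i hi).1, ?_, ?_, ?_⟩
    · intro i hi j hj hij
      apply hfi hi hj
      rw [← (hg i hi).2, ← (hg j hj).2, hij]
    · intro i hi
      have := hs i hi
      rw [← (hg _ hi).2, ← (hg i (by omega)).2] at this
      exact hss _ (h1 _ (hg _ hi).1).1 _ (h1 _ (hg i (by omega)).1).2.1 this
    · rw [← (hg 0 (by omega)).2, ← (hg (n-1) (by omega)).2] at hw
      exact hss _ (h1 _ (hg 0 (by omega)).1).1 _ (h1 _ (hg (n-1) (by omega)).1).2.1 hw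
  · have : criticalSet (φ '' Δ) ((fun p => (φ p.1, φ p.2)) '' P) ⊆ φ '' (criticalSet Δ P) := by
      rintro _ ⟨⟨s, hs, rfl⟩, h⟩
      refine ⟨s, ⟨hs, fun p hp => ?_⟩, rfl⟩
      have := h _ ⟨p, hp, rfl⟩
      exact ⟨fun e => this.1 (by rw [e]), fun e => this.2 (by rw [e])⟩
    exact (Set.ncard_le_ncard this (Set.toFinite _)).trans (Set.ncard_image_le (Set.toFinite _))

/-- Patchwork lemma for two pieces. -/
theorem patch_aux {A : Type*} [Finite A] (Δ Δ₁ Δ₂ : Set (Finset A)) (hΔ : Δ = Δ₁ ∪ Δ₂)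
    (hlow : ∀ s ∈ Δ₂, ∀ t ∈ Δ₁, ¬ s ⊆ t)
    (P Q : Set (Finset A × Finset A)) (hP : IsAcyclicMatching Δ₁ P)
    (hQ : IsAcyclicMatching Δ₂ Q) :
    IsAcyclicMatching Δ (P ∪ Q) ∧
      (criticalSet Δ (P ∪ Q)).ncard ≤ (criticalSet Δ₁ P).ncard + (criticalSet Δ₂ Q).ncard := by
  subst hΔ
  obtain ⟨⟨p1, p2⟩, p3⟩ := hP
  obtain ⟨⟨q1, q2⟩, q3⟩ := hQ
  have hne : ∀ s ∈ Δ₁, ∀ t ∈ Δ₂, s ≠ t := fun s hs t ht e => hlow t ht s hs e.symm.subset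
  refine ⟨⟨⟨?_, ?_⟩, ?_⟩, ?_⟩
  · rintro p (hp | hp)
    · obtain ⟨a, b, d⟩ := p1 p hp
      exact ⟨Or.inl a, Or.inl b, d⟩
    · obtain ⟨a, b, d⟩ := q1 p hp
      exact ⟨Or.inr a, Or.inr b, d⟩
  · rintro p (hp | hp) q (hq | hq) hpq
    · exact p2 p hp q hq hpq
    · obtain ⟨a, b, -⟩ := p1 p hp
      obtain ⟨a', b', -⟩ := q1 q hq
      exact ⟨hne _ a _ a', hne _ a _ b', hne _ b _ a', hne _ b _ b'⟩
    · obtain ⟨a, b, -⟩ := p1 q hq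
      obtain ⟨a', b', -⟩ := q1 p hp
      exact ⟨(hne _ a _ a').symm, (hne _ b _ a').symm, (hne _ a _ b').symm, (hne _ b _ b').symm⟩
    · exact q2 p hp q hq hpq
  · rintro ⟨n, hn, f, hf, hfi, hs, hw⟩
    have key : ∀ p ∈ P, ∀ q ∈ P ∪ Q, q.1 ⊂ p.2 → q ∈ P := by
      rintro p hp q (hq | hq) h
      · exact hq
      · exact absurd h.subset (hlow _ (q1 q hq).1 _ (p1 p hp).2.1)
    have step : ∀ i, f i ∈ P → ∀ j, i ≤ j → j < n → f j ∈ P := by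
      intro i hi j hij
      induction j, hij using Nat.le_induction with
      | base => exact fun _ => hi
      | succ j hj ih =>
        intro hjn
        exact key _ (ih (by omega)) _ (hf _ hjn) (hs j hjn)
    by_cases h0 : f 0 ∈ P
    · exact p3 ⟨n, hn, f, fun i hi => step 0 h0 i (by omega) hi, hfi, hs, hw⟩
    · refine q3 ⟨n, hn, f, fun i hi => ?_, hfi, hs, hw⟩
      rcases hf i hi with h | h
      · exact absurd (key _ (step i h (n-1) (by omega) (by omega)) _ (hf 0 (by omega)) hw) h0
      · exact h
  · have : criticalSet (Δ₁ ∪ Δ₂) (P ∪ Q) ⊆ criticalSet Δ₁ P ∪ criticalSet Δ₂ Q := by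
      rintro s ⟨h | h, h'⟩
      · exact Or.inl ⟨h, fun p hp => h' p (Or.inl hp)⟩
      · exact Or.inr ⟨h, fun p hp => h' p (Or.inr hp)⟩
    exact (Set.ncard_le_ncard this (Set.toFinite _)).trans (Set.ncard_union_le _ _)

def DS {V : Type*} (G : SimpleGraph V) (S : Set V) : Set (Finset V) :=
  {s | IsIndepSet G s ∧ ∀ u ∈ s, u ∈ S}

def Good {V : Type*} (G : SimpleGraph V) (S : Set V) (k : ℕ) : Prop :=
  ∃ P, IsAcyclicMatching (DS G S) P ∧ (criticalSet (DS G S) P).ncard ≤ k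

theorem Good.mono {V : Type*} {G : SimpleGraph V} {S : Set V} {k l : ℕ} (h : Good G S k)
    (hkl : k ≤ l) : Good G S l := by
  obtain ⟨P, h1, h2⟩ := h
  exact ⟨P, h1, h2.trans hkl⟩

theorem Good.del {V : Type*} [Finite V] {G : SimpleGraph V} {S : Set V} {k l : ℕ} (v : V)
    (hv : v ∈ S)
    (h1 : Good G (S \ {v}) k) (h2 : Good G {u ∈ S | u ≠ v ∧ ¬ G.Adj v u} l) :
    Good G S (k + l) := by
  obtain ⟨P, hP, hPk⟩ := h1
  obtain ⟨Q, hQ, hQl⟩ := h2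
  obtain ⟨Q', hQ', hQl'⟩ := transport_aux _ (fun s => insert v s) 1 (by
    rintro s ⟨-, hs⟩ t ⟨-, ht⟩
    constructor
    · intro h x hx
      have := h (Finset.mem_insert_of_mem hx)
      rw [Finset.mem_insert] at this
      rcases this with rfl | h
      · exact absurd rfl (hs _ hx).2.1
      · exact h
    · exact fun h => Finset.insert_subset_insert _ h) (by
    rintro s ⟨-, hs⟩
    exact Finset.card_insert_of_notMem fun h => (hs _ h).2.1 rfl) Q hQ
  obtain ⟨h, h'⟩ := patch_aux (DS G S) (DS G (S \ {v})) _ (by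
    ext s
    constructor
    · rintro ⟨hi, hs⟩
      by_cases hvs : v ∈ s
      · right
        refine ⟨s.erase v, ⟨fun a ha b hb => hi a (Finset.mem_of_mem_erase ha) b
          (Finset.mem_of_mem_erase hb), fun u hu => ?_⟩, Finset.insert_erase hvs⟩
        exact ⟨hs u (Finset.mem_of_mem_erase hu), Finset.ne_of_mem_erase hu,
          hi v hvs u (Finset.mem_of_mem_erase hu)⟩
      · left
        exact ⟨hi, fun u hu => ⟨hs u hu, fun e => hvs (by rw [← e]; exact hu)⟩⟩
    · rintro (⟨hi, hs⟩ | ⟨s, ⟨hi, hs⟩, rfl⟩)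
      · exact ⟨hi, fun u hu => (hs u hu).1⟩
      · constructor
        · intro a ha b hb hab
          simp only [Finset.mem_insert] at ha hb
          rcases ha with rfl | ha <;> rcases hb with rfl | hb
          · exact G.loopless.irrefl _ hab
          · exact (hs _ hb).2.2 hab
          · exact (hs _ ha).2.2 hab.symm
          · exact hi a ha b hb hab
        · intro u hu
          simp only [Finset.mem_insert] at hu
          rcases hu with rfl | hu
          · exact hv
          · exact (hs u hu).1) (by
    rintro _ ⟨s, hs, rfl⟩ t ⟨-, ht⟩ h
    exact (ht v (h (Finset.mem_insert_self _ _))).2 rfl) P Q' hP hQ'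
  exact ⟨_, h, h'.trans (by omega)⟩

theorem Good.isolated {V : Type*} [Finite V] {G : SimpleGraph V} {S : Set V} (v : V)
    (hv : v ∈ S) (h : ∀ u ∈ S, ¬ G.Adj v u) : Good G S 0 := by
  have hins : ∀ s ∈ DS G S, insert v s ∈ DS G S := by
    rintro s ⟨hi, hs⟩
    constructor
    · intro a ha b hb hab
      simp only [Finset.mem_insert] at ha hb
      rcases ha with rfl | ha <;> rcases hb with rfl | hb
      · exact G.loopless.irrefl _ hab
      · exact h _ (hs _ hb) hab
      · exact h _ (hs _ ha) hab.symm
      · exact hi a ha b hb hab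
    · intro u hu
      simp only [Finset.mem_insert] at hu
      rcases hu with rfl | hu
      · exact hv
      · exact (hs u hu)
  refine ⟨{p | p.1 ∈ DS G S ∧ v ∉ p.1 ∧ p.2 = insert v p.1}, ⟨⟨?_, ?_⟩, ?_⟩, ?_⟩
  · rintro ⟨p, q⟩ ⟨h1, h2, h3⟩
    simp only at h1 h2 h3
    subst h3
    exact ⟨h1, hins _ h1, Finset.subset_insert _ _, Finset.card_insert_of_notMem h2⟩
  · rintro ⟨p, q⟩ ⟨h1, h2, h3⟩ ⟨p', q'⟩ ⟨h1', h2', h3'⟩ hne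
    simp only at h1 h2 h3 h1' h2' h3'
    subst h3 h3'
    have : p ≠ p' := by rintro rfl; exact hne rfl
    refine ⟨this, ?_, ?_, ?_⟩
    · rintro e
      simp only at e
      exact h2 (e ▸ Finset.mem_insert_self _ _)
    · rintro e
      simp only at e
      exact h2' (e ▸ Finset.mem_insert_self _ _)
    · intro e
      simp only at e
      apply this
      rw [← Finset.erase_insert h2, ← Finset.erase_insert h2', e]
  · rintro ⟨n, hn, f, hf, hfi, hs, hw⟩
    have key : ∀ p q : Finset V × Finset V, (p.1 ∈ DS G S ∧ v ∉ p.1 ∧ p.2 = insert v p.1) →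
        (q.1 ∈ DS G S ∧ v ∉ q.1 ∧ q.2 = insert v q.1) → q.1 ⊂ p.2 → q.1 ⊆ p.1 := by
      rintro p q ⟨-, -, h⟩ ⟨-, h', -⟩ hss x hx
      have := hss.subset hx
      rw [h, Finset.mem_insert] at this
      rcases this with rfl | h
      · exact absurd hx h'
      · exact h
    have mono : ∀ j, 1 ≤ j → j < n → (f j).1 ⊆ (f 1).1 := by
      intro j hj
      induction j, hj using Nat.le_induction with
      | base => exact fun _ => Finset.Subset.refl _
      | succ j hj ih =>
        intro hjn
        exact (key _ _ (hf j (by omega)) (hf _ hjn) (hs j hjn)).trans (ih (by omega))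
    have a := key _ _ (hf 0 (by omega)) (hf 1 (by omega)) (hs 0 (by omega))
    have b := (key _ _ (hf (n-1) (by omega)) (hf 0 (by omega)) hw).trans
      (mono (n-1) (by omega) (by omega))
    have e : (f 0).1 = (f 1).1 := Finset.Subset.antisymm b a
    have e2 : f 0 = f 1 := by
      apply Prod.ext e
      rw [(hf 0 (by omega)).2.2, (hf 1 (by omega)).2.2, e]
    have := hfi (show 0 < n by omega) (show 1 < n by omega) e2
    omega
  · rw [Nat.le_zero, Set.ncard_eq_zero (Set.toFinite _), Set.eq_empty_iff_forall_notMem]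
    rintro s ⟨hs, hc⟩
    by_cases hvs : v ∈ s
    · refine (hc (s.erase v, s) ⟨⟨fun a ha b hb => hs.1 a (Finset.mem_of_mem_erase ha) b
        (Finset.mem_of_mem_erase hb), fun u hu => hs.2 u (Finset.mem_of_mem_erase hu)⟩,
        Finset.notMem_erase _ _, (Finset.insert_erase hvs).symm⟩).2 rfl
    · exact (hc (s, insert v s) ⟨hs, hvs, rfl⟩).1 rfl

theorem Good.leaf {V : Type*} [Finite V] {G : SimpleGraph V} {S : Set V} {k : ℕ} (u x : V)
    (hu : u ∈ S) (hx : x ∈ S) (hux : u ≠ x) (h : ∀ y ∈ S, G.Adj u y → y = x)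
    (h2 : Good G {u ∈ S | u ≠ x ∧ ¬ G.Adj x u} k) : Good G S k := by
  have := Good.del x hx (Good.isolated (G := G) (S := S \ {x}) u ⟨hu, hux⟩
    (fun y hy hadj => hy.2 (h y hy.1 hadj))) h2
  simpa using this

theorem cInv_mem {V : Type*} (G : SimpleGraph V) :
    ∃ P, IsAcyclicMatching (IndFaces G) P ∧
      (criticalSet (IndFaces G) P).ncard = cInvariant G := by
  have : cInvariant G ∈ {n | ∃ P, IsAcyclicMatching (IndFaces G) P ∧
      (criticalSet (IndFaces G) P).ncard = n} := by
    apply Nat.sInf_mem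
    refine ⟨_, ∅, ⟨⟨by simp, by simp⟩, ?_⟩, rfl⟩
    rintro ⟨n, hn, f, hf, -⟩
    exact hf 0 (by omega)
  exact this

theorem Good.of_induce {V : Type*} [Finite V] {G : SimpleGraph V} {S : Set V} {c : ℕ}
    (h : cInvariant (G.induce S) ≤ c) : Good G S c := by
  obtain ⟨P, hP, hc⟩ := cInv_mem (G.induce S)
  obtain ⟨P', hP', hc'⟩ := transport_aux _ (fun s : Finset S => s.map (Function.Embedding.subtype _))
    0 (by intro s _ t _; exact Finset.map_subset_map) (by intro s _; simp) P hP
  have e : (fun s : Finset S => s.map (Function.Embedding.subtype _)) '' IndFaces (G.induce S)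
      = DS G S := by
    ext s
    constructor
    · rintro ⟨s, hs, rfl⟩
      constructor
      · intro a ha b hb hab
        simp only [Finset.mem_map, Function.Embedding.subtype_apply] at ha hb
        obtain ⟨a, ha, rfl⟩ := ha
        obtain ⟨b, hb, rfl⟩ := hb
        exact hs a ha b hb hab
      · intro a ha
        simp only [Finset.mem_map, Function.Embedding.subtype_apply] at ha
        obtain ⟨a, ha, rfl⟩ := ha
        exact a.2
    · rintro ⟨hi, hs⟩
      refine ⟨s.subtype (· ∈ S), ?_, ?_⟩
      · intro a ha b hb hab
        rw [Finset.mem_subtype] at ha hb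
        exact hi a ha b hb hab
      · exact Finset.subtype_map_of_mem hs
  rw [e] at hP' hc'
  exact ⟨P', hP', by omega⟩

theorem Good.cInv_le {V : Type*} {G : SimpleGraph V} {c : ℕ}
    (h : Good G Set.univ c) : cInvariant G ≤ c := by
  obtain ⟨P, hP, hc⟩ := h
  have e : DS G Set.univ = IndFaces G := by
    ext s; simp [DS, IndFaces]
  rw [e] at hP hc
  unfold cInvariant
  refine (Nat.sInf_le ?_).trans hc
  exact ⟨P, hP, rfl⟩

noncomputable def cnt (B : ℤ → Prop) (a b : ℤ) : ℕ := ((Finset.Ico a b).filter B).card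

theorem cnt_sub (B : ℤ → Prop) (a b a' b' : ℤ) (ha : a ≤ a') (hb : b' ≤ b) (X : Finset ℤ)
    (hX : ∀ x ∈ X, B x ∧ a ≤ x ∧ x < b ∧ (x < a' ∨ b' ≤ x)) :
    cnt B a' b' + X.card ≤ cnt B a b := by
  unfold cnt
  rw [← Finset.card_union_of_disjoint]
  · apply Finset.card_le_card
    intro x hx
    simp only [Finset.mem_union, Finset.mem_filter, Finset.mem_Ico] at hx ⊢
    rcases hx with h | h
    · exact ⟨by omega, h.2⟩
    · have := hX x h
      exact ⟨by omega, this.1⟩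
  · rw [Finset.disjoint_left]
    intro x hx hx'
    simp only [Finset.mem_filter, Finset.mem_Ico] at hx
    have := hX x hx'
    omega

structure Rules (B : ℤ → Prop) (Q : ℤ → ℤ → ℕ → Prop) (M : ℤ) (c : ℕ) : Prop where
  mono : ∀ a b k l, k ≤ l → Q a b k → Q a b l
  e : ∀ a b, b ≤ a → Q a b c
  l : ∀ a b k, b - a ≤ M → ¬ B a → Q (a + 3) b k → Q a b k
  r : ∀ a b k, b - a ≤ M → ¬ B (b - 1) → Q a (b - 3) k → Q a b k
  w : ∀ a b k k', a < b → b - a ≤ M → Q (a + 1) b k → Q (a + 2) b k' → Q a b (k + k')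

theorem liter {B : ℤ → Prop} {Q : ℤ → ℤ → ℕ → Prop} {M : ℤ} {c : ℕ} (R : Rules B Q M c)
    (b : ℤ) (K : ℕ) (j : ℕ) : ∀ a, (∀ i : ℕ, i < j → ¬ B (a + 3 * i)) → b - a ≤ M →
      Q (a + 3 * j) b K → Q a b K := by
  induction j with
  | zero => intro a _ _ h; simpa using h
  | succ j ih =>
    intro a h hM hQ
    refine R.l _ _ _ hM (by simpa using h 0 (by omega)) (ih (a + 3) ?_ (by omega) ?_)
    · intro i hi
      have := h (i + 1) (by omega)
      push_cast at this
      rwa [show a + 3 + 3 * (i : ℤ) = a + 3 * (i + 1) by ring]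
    · push_cast at hQ
      rwa [show a + 3 + 3 * (j : ℤ) = a + 3 * (j + 1) by ring]

theorem riter {B : ℤ → Prop} {Q : ℤ → ℤ → ℕ → Prop} {M : ℤ} {c : ℕ} (R : Rules B Q M c)
    (a : ℤ) (K : ℕ) (j : ℕ) : ∀ b, (∀ i : ℕ, i < j → ¬ B (b - 1 - 3 * i)) → b - a ≤ M →
      Q a (b - 3 * j) K → Q a b K := by
  induction j with
  | zero => intro a _ _ h; simpa using h
  | succ j ih =>
    intro b h hM hQ
    refine R.r _ _ _ hM (by simpa using h 0 (by omega)) (ih (b - 3) ?_ (by omega) ?_)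
    · intro i hi
      have := h (i + 1) (by omega)
      push_cast at this
      rwa [show b - 3 - 1 - 3 * (i : ℤ) = b - 1 - 3 * (i + 1) by ring]
    · push_cast at hQ
      rwa [show b - 3 - 3 * (j : ℤ) = b - 3 * (j + 1) by ring]

theorem lft {B : ℤ → Prop} {Q : ℤ → ℤ → ℕ → Prop} {M : ℤ} {c : ℕ} (R : Rules B Q M c)
    (a f : ℤ) (hf : a - 1 ≤ f) (hB : ∀ i, a ≤ i → i < f → ¬ B i) (hmod : (f - a) % 3 ≠ 0) :
    ∃ a', f < a' ∧ a ≤ a' ∧ ∀ b K, b - a ≤ M → Q a' b K → Q a b K := by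
  refine ⟨a + 3 * (((f - a + 2) / 3).toNat : ℕ), by omega, by omega, fun b K hM hQ => ?_⟩
  refine liter R b K _ a (fun i hi => hB _ (by omega) (by omega)) hM hQ

theorem rgt {B : ℤ → Prop} {Q : ℤ → ℤ → ℕ → Prop} {M : ℤ} {c : ℕ} (R : Rules B Q M c)
    (b f : ℤ) (hf : f ≤ b) (hB : ∀ i, f < i → i < b → ¬ B i) (hmod : (b - 1 - f) % 3 ≠ 0) :
    ∃ b', b' ≤ f ∧ b' ≤ b ∧ ∀ a K, b - a ≤ M → Q a b' K → Q a b K := by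
  refine ⟨b - 3 * (((b - 1 - f + 2) / 3).toNat : ℕ), by omega, by omega, fun a K hM hQ => ?_⟩
  refine riter R a K _ b (fun i hi => hB _ (by omega) (by omega)) hM hQ

theorem exists_first (B : ℤ → Prop) (a b : ℤ) (h : ∃ i, a ≤ i ∧ i < b ∧ B i) :
    ∃ f, a ≤ f ∧ f < b ∧ B f ∧ ∀ i, a ≤ i → i < f → ¬ B i := by
  have hne : ((Finset.Ico a b).filter B).Nonempty := by
    obtain ⟨i, h1, h2, h3⟩ := h
    exact ⟨i, by simp [h1, h2, h3]⟩
  obtain ⟨f, hm, hl⟩ : ∃ f ∈ (Finset.Ico a b).filter B, ∀ i ∈ (Finset.Ico a b).filter B, f ≤ i :=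
    ⟨_, Finset.min'_mem _ hne, fun i hi => Finset.min'_le _ i hi⟩
  simp only [Finset.mem_filter, Finset.mem_Ico] at hm hl
  refine ⟨f, by omega, by omega, hm.2, fun i h1 h2 h3 => ?_⟩
  have := hl i ⟨by omega, h3⟩
  omega

theorem exists_last (B : ℤ → Prop) (a b : ℤ) (h : ∃ i, a ≤ i ∧ i < b ∧ B i) :
    ∃ f, a ≤ f ∧ f < b ∧ B f ∧ ∀ i, f < i → i < b → ¬ B i := by
  have hne : ((Finset.Ico a b).filter B).Nonempty := by
    obtain ⟨i, h1, h2, h3⟩ := h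
    exact ⟨i, by simp [h1, h2, h3]⟩
  obtain ⟨f, hm, hl⟩ : ∃ f ∈ (Finset.Ico a b).filter B, ∀ i ∈ (Finset.Ico a b).filter B, i ≤ f :=
    ⟨_, Finset.max'_mem _ hne, fun i hi => Finset.le_max' _ i hi⟩
  simp only [Finset.mem_filter, Finset.mem_Ico] at hm hl
  refine ⟨f, by omega, by omega, hm.2, fun i h1 h2 h3 => ?_⟩
  have := hl i ⟨by omega, h3⟩
  omega

theorem cnt_zero (B : ℤ → Prop) (a b : ℤ) (h : ∀ i, a ≤ i → i < b → ¬ B i) : cnt B a b = 0 := by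
  unfold cnt
  rw [Finset.card_eq_zero, Finset.filter_eq_empty_iff]
  intro i hi
  rw [Finset.mem_Ico] at hi
  exact h i hi.1 hi.2

theorem path_bound {B : ℤ → Prop} {Q : ℤ → ℤ → ℕ → Prop} {M : ℤ} {c : ℕ} (R : Rules B Q M c)
    (N : ℕ) : ∀ a b, (b - a).toNat ≤ N → b - a ≤ M → Q a b (c * Nat.fib (cnt B a b + 2)) := by
  have fpos : ∀ k, 1 ≤ Nat.fib (k + 2) := fun k => Nat.fib_pos.2 (by omega)
  induction N with
  | zero =>
    intro a b h hM
    exact R.mono _ _ _ _ (Nat.le_mul_of_pos_right _ (fpos _)) (R.e a b (by omega))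
  | succ N ih =>
    intro a b h hM
    by_cases hab : b ≤ a
    · exact R.mono _ _ _ _ (Nat.le_mul_of_pos_right _ (fpos _)) (R.e a b (by omega))
    by_cases hB : B a
    · by_cases hex : ∃ i, a + 1 ≤ i ∧ i < b ∧ B i
      · obtain ⟨f, f1, f2, f3, f4⟩ := exists_first B _ _ hex
        have c2 : ∀ a', f < a' → cnt B a' b + 2 ≤ cnt B a b := by
          intro a' h'
          have := cnt_sub B a b a' b (by omega) le_rfl {a, f} (by
            intro x hx
            simp only [Finset.mem_insert, Finset.mem_singleton] at hx
            rcases hx with rfl | rfl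
            · exact ⟨hB, by omega⟩
            · exact ⟨f3, by omega⟩)
          rwa [Finset.card_pair (by omega)] at this
        have c1 : ∀ a', a < a' → cnt B a' b + 1 ≤ cnt B a b := by
          intro a' h'
          exact cnt_sub B a b a' b (by omega) le_rfl {a} (by
            intro x hx
            simp only [Finset.mem_singleton] at hx
            subst hx
            exact ⟨hB, by omega⟩)
        have main : ∀ K K', Q (a + 1) b (c * Nat.fib (K + 2)) → Q (a + 2) b (c * Nat.fib (K' + 2)) →
            ((K + 2 ≤ cnt B a b ∧ K' + 1 ≤ cnt B a b) ∨ (K + 1 ≤ cnt B a b ∧ K' + 2 ≤ cnt B a b)) →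
            Q a b (c * Nat.fib (cnt B a b + 2)) := by
          intro K K' hK hK' hor
          refine R.mono _ _ _ _ ?_ (R.w a b _ _ (by omega) hM hK hK')
          rw [← mul_add]
          apply Nat.mul_le_mul_left
          rw [Nat.fib_add_two (n := cnt B a b)]
          rcases hor with ⟨h1, h2⟩ | ⟨h1, h2⟩
          · exact add_le_add (Nat.fib_mono h1) (Nat.fib_mono (by omega))
          · rw [add_comm]
            exact add_le_add (Nat.fib_mono h2) (Nat.fib_mono (by omega))
        by_cases hd : (f - a) % 3 = 1
        · obtain ⟨a', g1, g2, g3⟩ := lft R (a + 2) f (by omega)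
            (fun i hi hi' => f4 i (by omega) hi') (by omega)
          exact main _ _ (ih (a + 1) b (by omega) (by omega))
            (g3 _ _ (by omega) (ih a' b (by omega) (by omega)))
            (Or.inr ⟨c1 _ (by omega), c2 _ g1⟩)
        · obtain ⟨a', g1, g2, g3⟩ := lft R (a + 1) f (by omega)
            (fun i hi hi' => f4 i (by omega) hi') (by omega)
          exact main _ _ (g3 _ _ (by omega) (ih a' b (by omega) (by omega)))
            (ih (a + 2) b (by omega) (by omega))
            (Or.inl ⟨c2 _ g1, c1 _ (by omega)⟩)
      · push Not at hex
        have h1 := ih (a + 1) b (by omega) (by omega)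
        have h2 := ih (a + 2) b (by omega) (by omega)
        have z1 : cnt B (a + 1) b = 0 := cnt_zero _ _ _ hex
        have z2 : cnt B (a + 2) b = 0 := cnt_zero _ _ _ fun i hi hi' => hex i (by omega) hi'
        rw [z1] at h1
        rw [z2] at h2
        have := cnt_sub B a b (a + 1) b (by omega) le_rfl {a} (by
            intro x hx
            simp only [Finset.mem_singleton] at hx
            subst hx
            exact ⟨hB, by omega⟩)
        rw [Finset.card_singleton] at this
        refine R.mono _ _ _ _ ?_ (R.w a b _ _ (by omega) hM h1 h2)
        rw [← mul_add]
        apply Nat.mul_le_mul_left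
        have : Nat.fib 3 ≤ Nat.fib (cnt B a b + 2) := Nat.fib_mono (by omega)
        simpa [Nat.fib_add_two] using this
    · have h1 := ih (a + 3) b (by omega) (by omega)
      have := cnt_sub B a b (a + 3) b (by omega) le_rfl ∅ (by simp)
      refine R.l _ _ _ hM hB (R.mono _ _ _ _ ?_ h1)
      exact Nat.mul_le_mul_left _ (Nat.fib_mono (by simp at this; omega))

theorem fib_ineq (k n x y : ℕ) (hk : 2 ≤ k) (hkn : k ≤ n)
    (h : ((x + 3 ≤ k ∨ x = 0) ∧ y + 1 ≤ k) ∨ (x + 2 ≤ k ∧ y + 2 ≤ k) ∨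
      ((y + 3 ≤ k ∨ y = 0) ∧ x + 1 ≤ k)) :
    Nat.fib (x + 2) + Nat.fib (y + 2) ≤ lucas n := by
  obtain ⟨k, rfl⟩ : ∃ j, k = j + 2 := ⟨k - 2, by omega⟩
  obtain ⟨n, rfl⟩ : ∃ j, n = j + 2 := ⟨n - 2, by omega⟩
  have e : lucas (n + 2) = Nat.fib (n + 1) + Nat.fib (n + 3) := rfl
  rw [e]
  have m1 : Nat.fib (k + 1) ≤ Nat.fib (n + 1) := Nat.fib_mono (by omega)
  have m2 : Nat.fib (k + 3) ≤ Nat.fib (n + 3) := Nat.fib_mono (by omega)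
  have key : ∀ z, (z + 3 ≤ k + 2 ∨ z = 0) → Nat.fib (z + 2) ≤ Nat.fib (k + 1) := by
    rintro z (hz | rfl)
    · exact Nat.fib_mono (by omega)
    · exact (Nat.fib_pos.2 (by omega) : 0 < Nat.fib (k + 1))
  have key1 : ∀ z, z + 1 ≤ k + 2 → Nat.fib (z + 2) ≤ Nat.fib (k + 3) :=
    fun z hz => Nat.fib_mono (by omega)
  have key2 : ∀ z, z + 2 ≤ k + 2 → Nat.fib (z + 2) ≤ Nat.fib (k + 2) :=
    fun z hz => Nat.fib_mono (by omega)
  have r1 : Nat.fib (k + 3) = Nat.fib (k + 1) + Nat.fib (k + 2) := Nat.fib_add_two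
  have r2 : Nat.fib (k + 2) = Nat.fib k + Nat.fib (k + 1) := Nat.fib_add_two
  have r3 : Nat.fib k ≤ Nat.fib (k + 1) := Nat.fib_mono (by omega)
  rcases h with ⟨h1, h2⟩ | ⟨h1, h2⟩ | ⟨h1, h2⟩
  · have := key _ h1; have := key1 _ h2; omega
  · have := key2 _ h1; have := key2 _ h2; omega
  · have := key _ h1; have := key1 _ h2; omega

theorem cycle_bound {B : ℤ → Prop} {Q : ℤ → ℤ → ℕ → Prop} {m : ℤ} {c n : ℕ}
    (R : Rules B Q (m - 1) c) (hn : 2 ≤ n) (T : ℕ → Prop)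
    (hT : ∀ k l, k ≤ l → T k → T l)
    (hcyc : ∀ a k k', Q (a + 1) (a + m) k → Q (a + 2) (a + m - 1) k' → T (k + k'))
    (hcnt : ∀ a, cnt B a (a + m) ≤ n) : T (c * lucas n) := by
  have zero : ∀ a, (∀ i, a + 1 ≤ i → i < a + m → ¬ B i) → T (c * lucas n) := by
    intro a ha
    have h1 := path_bound R _ (a + 1) (a + m) le_rfl (by omega)
    have h2 := path_bound R _ (a + 2) (a + m - 1) le_rfl (by omega)
    rw [cnt_zero _ _ _ ha] at h1
    rw [cnt_zero _ _ _ fun i hi hi' => ha i (by omega) (by omega)] at h2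
    refine hT _ _ ?_ (hcyc a _ _ h1 h2)
    rw [← mul_add]
    exact Nat.mul_le_mul_left _ (fib_ineq 2 n 0 0 le_rfl hn (by omega))
  by_cases hB : ∃ i, B i
  swap
  · push Not at hB
    exact zero 0 fun i _ _ => hB i
  obtain ⟨a, ha⟩ := hB
  by_cases hex : ∃ i, a + 1 ≤ i ∧ i < a + m ∧ B i
  swap
  · push Not at hex
    exact zero a hex
  obtain ⟨f, f1, f2, f3, f4⟩ := exists_first B _ _ hex
  obtain ⟨l, l1, l2, l3, l4⟩ := exists_last B _ _ hex
  have hfl : f ≤ l := by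
    by_contra hh
    exact f4 l l1 (by omega) l3
  obtain ⟨a1, a2, ha1, ha2, red1, red2, hor⟩ : ∃ a1 a2, a + 1 ≤ a1 ∧ a + 2 ≤ a2 ∧
      (∀ b K, b - (a + 1) ≤ m - 1 → Q a1 b K → Q (a + 1) b K) ∧
      (∀ b K, b - (a + 2) ≤ m - 1 → Q a2 b K → Q (a + 2) b K) ∧ (f < a1 ∨ f < a2) := by
    by_cases hd : (f - a) % 3 = 1
    · obtain ⟨a', g1, g2, g3⟩ := lft R (a + 2) f (by omega)
        (fun i hi hi' => f4 i (by omega) hi') (by omega)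
      exact ⟨a + 1, a', by omega, by omega, fun _ _ _ h => h, g3, Or.inr g1⟩
    · obtain ⟨a', g1, g2, g3⟩ := lft R (a + 1) f (by omega)
        (fun i hi hi' => f4 i (by omega) hi') (by omega)
      exact ⟨a', a + 2, by omega, by omega, g3, fun _ _ _ h => h, Or.inl g1⟩
  obtain ⟨b1, b2, hb1, hb2, red1', red2', hor'⟩ : ∃ b1 b2, b1 ≤ a + m ∧ b2 ≤ a + m - 1 ∧
      (∀ x K, a + m - x ≤ m - 1 → Q x b1 K → Q x (a + m) K) ∧
      (∀ x K, a + m - 1 - x ≤ m - 1 → Q x b2 K → Q x (a + m - 1) K) ∧ (b1 ≤ l ∨ b2 ≤ l) := by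
    by_cases hd : (a + m - l) % 3 = 1
    · obtain ⟨b', g1, g2, g3⟩ := rgt R (a + m - 1) l (by omega)
        (fun i hi hi' => l4 i (by omega) (by omega)) (by omega)
      exact ⟨a + m, b', by omega, by omega, fun _ _ _ h => h, g3, Or.inr g1⟩
    · obtain ⟨b', g1, g2, g3⟩ := rgt R (a + m) l (by omega)
        (fun i hi hi' => l4 i (by omega) (by omega)) (by omega)
      exact ⟨b', a + m - 1, by omega, by omega, g3, fun _ _ _ h => h, Or.inl g1⟩
  have h1 := red1 _ _ (by omega) (red1' _ _ (by omega)
    (path_bound R _ a1 b1 le_rfl (by omega)))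
  have h2 := red2 _ _ (by omega) (red2' _ _ (by omega)
    (path_bound R _ a2 b2 le_rfl (by omega)))
  have k2 : 2 ≤ cnt B a (a + m) := by
    have := cnt_sub B a (a + m) (a + m) (a + m) (by omega) le_rfl {a, f} (by
      intro x hx
      simp only [Finset.mem_insert, Finset.mem_singleton] at hx
      rcases hx with rfl | rfl
      · exact ⟨ha, by omega⟩
      · exact ⟨f3, by omega⟩)
    rw [Finset.card_pair (by omega)] at this
    omega
  have c1 : ∀ a' b', a + 1 ≤ a' → b' ≤ a + m → cnt B a' b' + 1 ≤ cnt B a (a + m) := by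
    intro a' b' h h'
    exact cnt_sub B _ _ _ _ (by omega) (by omega) {a} (by
      intro x hx
      simp only [Finset.mem_singleton] at hx
      subst hx
      exact ⟨ha, by omega⟩)
  have c2 : ∀ a' b', a + 1 ≤ a' → b' ≤ a + m → (f < a' ∨ b' ≤ l) →
      cnt B a' b' + 2 ≤ cnt B a (a + m) := by
    rintro a' b' h h' (h'' | h'')
    · have := cnt_sub B a (a + m) a' b' (by omega) (by omega) {a, f} (by
        intro x hx
        simp only [Finset.mem_insert, Finset.mem_singleton] at hx
        rcases hx with rfl | rfl
        · exact ⟨ha, by omega⟩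
        · exact ⟨f3, by omega⟩)
      rwa [Finset.card_pair (by omega)] at this
    · have := cnt_sub B a (a + m) a' b' (by omega) (by omega) {a, l} (by
        intro x hx
        simp only [Finset.mem_insert, Finset.mem_singleton] at hx
        rcases hx with rfl | rfl
        · exact ⟨ha, by omega⟩
        · exact ⟨l3, by omega⟩)
      rwa [Finset.card_pair (by omega)] at this
  have c3 : ∀ a' b', a + 1 ≤ a' → b' ≤ a + m → f < a' → b' ≤ l →
      cnt B a' b' + 3 ≤ cnt B a (a + m) ∨ cnt B a' b' = 0 := by
    intro a' b' h h' hf hl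
    rcases hfl.eq_or_lt with e | e
    · right
      exact cnt_zero _ _ _ fun i hi hi' => l4 i (by omega) (by omega)
    · left
      have := cnt_sub B a (a + m) a' b' (by omega) (by omega) {a, f, l} (by
        intro x hx
        simp only [Finset.mem_insert, Finset.mem_singleton] at hx
        rcases hx with rfl | rfl | rfl
        · exact ⟨ha, by omega⟩
        · exact ⟨f3, by omega⟩
        · exact ⟨l3, by omega⟩)
      rwa [Finset.card_eq_three.2 ⟨a, f, l, by omega, by omega, by omega, rfl⟩] at this
  refine hT _ _ ?_ (hcyc a _ _ h1 h2)
  rw [← mul_add]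
  refine Nat.mul_le_mul_left _ (fib_ineq (cnt B a (a + m)) n _ _ k2 (hcnt a) ?_)
  rcases hor with h | h <;> rcases hor' with h' | h'
  · exact Or.inl ⟨c3 _ _ (by omega) (by omega) h h', c1 _ _ (by omega) (by omega)⟩
  · exact Or.inr (Or.inl ⟨c2 _ _ (by omega) (by omega) (Or.inl h), c2 _ _ (by omega) (by omega) (Or.inr h')⟩)
  · exact Or.inr (Or.inl ⟨c2 _ _ (by omega) (by omega) (Or.inr h'), c2 _ _ (by omega) (by omega) (Or.inl h)⟩)
  · exact Or.inr (Or.inr ⟨c3 _ _ (by omega) (by omega) h h', c1 _ _ (by omega) (by omega)⟩)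

theorem emod_shift (m i j : ℤ) (hij : i < j) (hjm : j < i + m) :
    j % m = i % m + (j - i) ∨ j % m = i % m + (j - i) - m := by
  have h0 := Int.emod_nonneg i (show m ≠ 0 by omega)
  have h1 := Int.emod_lt_of_pos i (show 0 < m by omega)
  have e : j % m = (i % m + (j - i)) % m := by
    rw [Int.emod_add_emod]; congr 1; ring
  by_cases h : i % m + (j - i) < m
  · left
    rw [e, Int.emod_eq_of_lt (by omega) h]
  · right
    rw [e, ← Int.sub_emod_right, Int.emod_eq_of_lt (by omega) (by omega)]

theorem cycle_param {V : Type*} (G : SimpleGraph V) (C : Set V) (m : ℕ) (hm : 3 ≤ m)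
    (e : G.induce C ≃g SimpleGraph.cycleGraph m) :
    ∃ p : ℤ → V, (∀ i, p i ∈ C) ∧ (∀ i j : ℤ, i < j → j < i + m → p i ≠ p j) ∧
      (∀ i j : ℤ, i < j → j < i + m → (G.Adj (p i) (p j) ↔ j = i + 1 ∨ j = i + m - 1)) ∧
      (∀ a : ℤ, ∀ v ∈ C, ∃ i : ℤ, a ≤ i ∧ i < a + m ∧ p i = v) := by
  have h0 : ∀ i : ℤ, 0 ≤ i % m := fun i => Int.emod_nonneg i (by omega)
  have h1 : ∀ i : ℤ, i % m < m := fun i => Int.emod_lt_of_pos i (by omega)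
  have h2 : ∀ i : ℤ, (i % m).toNat < m := fun i => by have := h0 i; have := h1 i; omega
  refine ⟨fun i => (e.symm ⟨(i % m).toNat, h2 i⟩ : C), fun i => Subtype.coe_prop _, ?_, ?_, ?_⟩
  · intro i j hij hjm h
    have := e.symm.injective (Subtype.ext h)
    rw [Fin.mk.injEq] at this
    have := emod_shift m i j hij hjm
    have := h0 i; have := h0 j
    omega
  · intro i j hij hjm
    have hs := emod_shift m i j hij hjm
    have := h0 i; have := h0 j; have := h1 i; have := h1 j
    have e1 : G.Adj (e.symm ⟨(i % m).toNat, h2 i⟩ : C) (e.symm ⟨(j % m).toNat, h2 j⟩ : C) ↔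
        (SimpleGraph.cycleGraph m).Adj ⟨(i % m).toNat, h2 i⟩ ⟨(j % m).toNat, h2 j⟩ := by
      rw [← e.symm.map_adj_iff]
      rfl
    rw [e1, SimpleGraph.cycleGraph_adj']
    rcases hs with hs | hs
    · rw [Fin.coe_sub_iff_lt.2, Fin.coe_sub_iff_le.2]
      · simp only; omega
      · simp only [Fin.mk_le_mk]; omega
      · simp only [Fin.mk_lt_mk]; omega
    · rw [Fin.coe_sub_iff_le.2, Fin.coe_sub_iff_lt.2]
      · simp only; omega
      · simp only [Fin.mk_lt_mk]; omega
      · simp only [Fin.mk_le_mk]; omega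
  · intro a v hv
    refine ⟨a + (((e ⟨v, hv⟩ : Fin m) : ℕ) - a : ℤ) % m, ?_, ?_, ?_⟩
    · have := h0 (((e ⟨v, hv⟩ : Fin m) : ℕ) - a : ℤ); omega
    · have := h1 (((e ⟨v, hv⟩ : Fin m) : ℕ) - a : ℤ); omega
    · have e2 : (a + (((e ⟨v, hv⟩ : Fin m) : ℕ) - a : ℤ) % m) % m = ((e ⟨v, hv⟩ : Fin m) : ℕ) := by
        rw [Int.add_emod_emod, add_sub_cancel, Int.emod_eq_of_lt (by omega)]
        exact_mod_cast (e ⟨v, hv⟩).2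
      have e3 : (⟨((a + (((e ⟨v, hv⟩ : Fin m) : ℕ) - a : ℤ) % m) % m).toNat, h2 _⟩ : Fin m)
          = e ⟨v, hv⟩ := by
        apply Fin.ext
        simp only [e2]
        simp
      simp only [e3]
      simp

def QQ {V : Type*} (G : SimpleGraph V) (C : Set V) (p : ℤ → V) (a b : ℤ) (K : ℕ) : Prop :=
  ∀ H : Set V, H ⊆ Cᶜ → Good G (H ∪ p '' Set.Ico a b) K

theorem rules_hold {V : Type*} [Finite V] (G : SimpleGraph V) (C : Set V) (p : ℤ → V) (m : ℤ)
    (hpC : ∀ i, p i ∈ C) (hinj : ∀ i j, i < j → j < i + m → p i ≠ p j)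
    (hadj : ∀ i j, i < j → j < i + m → (G.Adj (p i) (p j) ↔ j = i + 1 ∨ j = i + m - 1))
    (c : ℕ) (hc : ∀ S : Set V, S ⊆ Cᶜ → Good G S c) :
    Rules (fun i => ∃ w ∉ C, G.Adj (p i) w) (QQ G C p) (m - 1) c := by
  have hinj' : ∀ i j, i < j + m → j < i + m → p i = p j → i = j := by
    intro i j h1 h2 e
    rcases lt_trichotomy i j with h | h | h
    · exact absurd e (hinj i j h h2)
    · exact h
    · exact absurd e.symm (hinj j i h h1)
  have hadj' : ∀ i j, i < j + m - 1 → j < i + m - 1 →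
      (G.Adj (p i) (p j) ↔ (i = j + 1 ∨ j = i + 1)) := by
    intro i j h1 h2
    rcases lt_trichotomy i j with h | h | h
    · rw [hadj i j h (by omega)]; omega
    · subst h
      constructor
      · intro h; exact absurd h (G.loopless.irrefl _)
      · omega
    · rw [G.adj_comm, hadj j i h (by omega)]; omega
  have nb : ∀ H : Set V, H ⊆ Cᶜ → ∀ a b j, b - a ≤ m - 1 → a ≤ j → j < b → ∀ a' b',
      (∀ i, (a' ≤ i ∧ i < b') ↔ (a ≤ i ∧ i < b ∧ i ≠ j ∧ i ≠ j + 1 ∧ j ≠ i + 1)) →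
      {u ∈ H ∪ p '' Set.Ico a b | u ≠ p j ∧ ¬ G.Adj (p j) u} =
        {u ∈ H | ¬ G.Adj (p j) u} ∪ p '' Set.Ico a' b' := by
    intro H hH a b j hab h1 h2 a' b' hi
    ext u
    constructor
    · rintro ⟨hu | ⟨i, ⟨i1, i2⟩, rfl⟩, h3, h4⟩
      · exact Or.inl ⟨hu, h4⟩
      · right
        refine ⟨i, (hi i).2 ⟨i1, i2, ?_, ?_⟩, rfl⟩
        · rintro rfl; exact h3 rfl
        · rw [hadj' j i (by omega) (by omega)] at h4
          omega
    · rintro (⟨hu, h4⟩ | ⟨i, hi', rfl⟩)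
      · exact ⟨Or.inl hu, fun e => hH hu (e ▸ hpC j), h4⟩
      · obtain ⟨i1, i2, i3, i4⟩ := (hi i).1 hi'
        refine ⟨Or.inr ⟨i, ⟨i1, i2⟩, rfl⟩, fun e => i3 (hinj' i j (by omega) (by omega) e), ?_⟩
        rw [hadj' j i (by omega) (by omega)]
        omega
  have hempty : ∀ a b a' b' : ℤ, b ≤ a → b' ≤ a' → Set.Ico a b = Set.Ico a' b' := by
    intro a b a' b' h h'
    rw [Set.Ico_eq_empty (by omega), Set.Ico_eq_empty (by omega)]
  -- reduction at a leaf `u`, neighbour `x`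
  have leaf : ∀ a b u x a' b' K, b - a ≤ m - 1 → a ≤ u → u < b → a ≤ x → x < b → x ≠ u →
      (∀ i, a ≤ i → i < b → (i = u + 1 ∨ u = i + 1) → i = x) →
      (∀ i, (a' ≤ i ∧ i < b') ↔ (a ≤ i ∧ i < b ∧ i ≠ x ∧ i ≠ x + 1 ∧ x ≠ i + 1)) →
      (¬ ∃ w ∉ C, G.Adj (p u) w) → QQ G C p a' b' K → QQ G C p a b K := by
    intro a b u x a' b' K hab u1 u2 x1 x2 hxu hnb hi hB hQ H hH
    refine Good.leaf (p u) (p x) (Or.inr ⟨u, ⟨u1, u2⟩, rfl⟩) (Or.inr ⟨x, ⟨x1, x2⟩, rfl⟩)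
      (fun e => hxu (hinj' _ _ (by omega) (by omega) e).symm) ?_ ?_
    · rintro y (hy | ⟨i, ⟨i1, i2⟩, rfl⟩) h
      · exact absurd ⟨y, hH hy, h⟩ hB
      · rw [hadj' _ _ (by omega) (by omega)] at h
        rw [hnb i i1 i2 (by omega)]
    · rw [nb H hH a b x hab x1 x2 a' b' hi]
      exact hQ _ fun y hy => hH hy.1
  have iso : ∀ a b K, b = a + 1 → 1 ≤ m - 1 → (¬ ∃ w ∉ C, G.Adj (p a) w) → QQ G C p a b K := by
    intro a b K hb hm hB H hH
    refine (Good.isolated (p a) (Or.inr ⟨a, ⟨le_rfl, by omega⟩, rfl⟩) ?_).mono (Nat.zero_le K)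
    rintro y (hy | ⟨i, ⟨i1, i2⟩, rfl⟩) h
    · exact hB ⟨y, hH hy, h⟩
    · rw [hadj' _ _ (by omega) (by omega)] at h
      omega
  constructor
  · intro a b k l hkl h H hH
    exact (h H hH).mono hkl
  · intro a b hab H hH
    rw [Set.Ico_eq_empty (by omega), Set.image_empty, Set.union_empty]
    exact hc H hH
  · intro a b k hab hB hQ
    by_cases h1 : b ≤ a
    · intro H hH
      rw [hempty a b (a + 3) b h1 (by omega)]
      exact hQ H hH
    by_cases h2 : b = a + 1
    · exact iso a b k h2 (by omega) hB
    · exact leaf a b a (a + 1) (a + 3) b k hab (by omega) (by omega) (by omega) (by omega)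
        (by omega) (by omega) (by omega) hB hQ
  · intro a b k hab hB hQ
    by_cases h1 : b ≤ a
    · intro H hH
      rw [hempty a b a (b - 3) h1 (by omega)]
      exact hQ H hH
    by_cases h2 : b = a + 1
    · refine iso a b k h2 (by omega) ?_
      rwa [show b - 1 = a by omega] at hB
    · exact leaf a b (b - 1) (b - 2) a (b - 3) k hab (by omega) (by omega) (by omega) (by omega)
        (by omega) (by omega) (by omega) hB hQ
  · intro a b k k' hab hM h1 h2 H hH
    refine Good.del (p a) (Or.inr ⟨a, ⟨le_rfl, hab⟩, rfl⟩) ?_ ?_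
    · convert h1 H hH using 1
      ext u
      constructor
      · rintro ⟨hu | ⟨i, ⟨i1, i2⟩, rfl⟩, h3⟩
        · exact Or.inl hu
        · refine Or.inr ⟨i, ⟨?_, i2⟩, rfl⟩
          have : i ≠ a := by rintro rfl; exact h3 rfl
          omega
      · rintro (hu | ⟨i, ⟨i1, i2⟩, rfl⟩)
        · exact ⟨Or.inl hu, fun e => hH hu (by rw [Set.mem_singleton_iff.1 e]; exact hpC a)⟩
        · refine ⟨Or.inr ⟨i, ⟨by omega, i2⟩, rfl⟩, fun e => ?_⟩
          have := hinj' i a (by omega) (by omega) e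
          omega
    · rw [nb H hH a b a hM le_rfl hab (a + 2) b (by omega)]
      exact h2 _ fun y hy => hH hy.1

/-- If `C` induces a cycle in `G`, at most `n ≥ 2` vertices of `C` have neighbours outside
`C`, and `c(H) ≤ c` for every induced subgraph `H` of `G \ C`, then `c(G) ≤ c · ℓ(n)`. -/
theorem statement_14 {V : Type*} [Finite V] (G : SimpleGraph V) (C : Set V)
    (n c : ℕ) (hn : 2 ≤ n)
    (hcycle : ∃ m, 3 ≤ m ∧ Nonempty (G.induce C ≃g SimpleGraph.cycleGraph m))
    (hboundary : {v ∈ C | ∃ w ∉ C, G.Adj v w}.ncard ≤ n)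
    (hsub : ∀ S : Set V, S ⊆ Cᶜ → cInvariant (G.induce S) ≤ c) :
    cInvariant G ≤ c * lucas n := by
  obtain ⟨m, hm, ⟨e⟩⟩ := hcycle
  obtain ⟨p, hpC, hinj, hadj, hsurj⟩ := cycle_param G C m hm e
  have R := rules_hold G C p m hpC hinj hadj c (fun S hS => Good.of_induce (hsub S hS))
  apply Good.cInv_le
  refine cycle_bound R hn (Good G Set.univ) (fun k l hkl h => h.mono hkl) ?_ ?_
  · intro a k k' h1 h2
    refine Good.del (p a) (Set.mem_univ _) ?_ ?_
    · convert h1 Cᶜ le_rfl using 1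
      ext u
      constructor
      · rintro ⟨-, h3⟩
        by_cases hu : u ∈ C
        · obtain ⟨i, i1, i2, rfl⟩ := hsurj a u hu
          refine Or.inr ⟨i, ⟨?_, i2⟩, rfl⟩
          have : i ≠ a := by rintro rfl; exact h3 rfl
          omega
        · exact Or.inl hu
      · rintro (hu | ⟨i, ⟨i1, i2⟩, rfl⟩)
        · exact ⟨Set.mem_univ _, fun e => hu (by rw [Set.mem_singleton_iff.1 e]; exact hpC a)⟩
        · exact ⟨Set.mem_univ _, fun e => hinj a i (by omega) i2 (Set.mem_singleton_iff.1 e).symm⟩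
    · convert h2 {u ∈ Cᶜ | ¬ G.Adj (p a) u} (fun u hu => hu.1) using 1
      ext u
      constructor
      · rintro ⟨-, h3, h4⟩
        by_cases hu : u ∈ C
        · obtain ⟨i, i1, i2, rfl⟩ := hsurj a u hu
          have : i ≠ a := by rintro rfl; exact h3 rfl
          rw [hadj a i (by omega) i2] at h4
          exact Or.inr ⟨i, ⟨by omega, by omega⟩, rfl⟩
        · exact Or.inl ⟨hu, h4⟩
      · rintro (⟨hu, h4⟩ | ⟨i, ⟨i1, i2⟩, rfl⟩)
        · exact ⟨Set.mem_univ _, fun e => hu (e ▸ hpC a), h4⟩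
        · refine ⟨Set.mem_univ _, fun e => hinj a i (by omega) (by omega) e.symm, ?_⟩
          rw [hadj a i (by omega) (by omega)]
          omega
  · intro a
    refine le_trans ?_ hboundary
    unfold cnt
    rw [← Set.ncard_coe_finset]
    refine Set.ncard_le_ncard_of_injOn p ?_ ?_ (Set.toFinite _)
    · intro i hi
      simp only [Finset.coe_filter, Set.mem_ofPred_eq] at hi
      exact ⟨hpC i, hi.2⟩
    · intro i hi j hj hij
      simp only [Finset.coe_filter, Set.mem_ofPred_eq, Finset.mem_Ico] at hi hj
      rcases lt_trichotomy i j with h | h | h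
      · exact absurd hij (hinj i j h (by omega))
      · exact h
      · exact absurd hij.symm (hinj j i h (by omega))
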